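/- For n ≥ 3, the border rank of the reduced matrix multiplication tensor M_⟨n⟩^red = M_⟨n⟩ − Σ_{j=1}^n x^1_n ⊗ y^n_j ⊗ z^j_1 satisfies R̲(M_⟨n⟩^red) ≥ 2n² − n. -/

import Mathlib

open scoped BigOperators

/-- A tensor `T`, given by its coordinate array, has rank at most `r`. -/
def tensorRankLE {ιa ιb ιc : Type*} (r : ℕ) (T : ιa → ιb → ιc → ℂ) : Prop :=
  ∃ (u : Fin r → ιa → ℂ) (v : Fin r → ιb → ℂ) (w : Fin r → ιc → ℂ),
    ∀ i j k, T i j k = ∑ l, u l i * v l j * w l k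

/-- `T` has border rank at most `r`. -/
def borderRankLE {ιa ιb ιc : Type*} (r : ℕ) (T : ιa → ιb → ιc → ℂ) : Prop :=
  T ∈ closure {S : ιa → ιb → ιc → ℂ | tensorRankLE r S}

/-- The border rank of a tensor. -/
noncomputable def borderRank {ιa ιb ιc : Type*} (T : ιa → ιb → ιc → ℂ) : ℕ :=
  sInf {r | borderRankLE r T}

/-- The matrix multiplication tensor `M_⟨n⟩ = ∑_{i,j,k} x^i_j ⊗ y^j_k ⊗ z^k_i`, where
`A = U* ⊗ V`, `B = V* ⊗ W`, `C = W* ⊗ U` all have matrix-unit bases indexed by `Fin n × Fin n`. -/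
def matMulTensor (n : ℕ) : (Fin n × Fin n) → (Fin n × Fin n) → (Fin n × Fin n) → ℂ :=
  fun a b c => if a.2 = b.1 ∧ b.2 = c.1 ∧ c.2 = a.1 then 1 else 0

/-- The reduced matrix multiplication tensor
`M_⟨n⟩^red = M_⟨n⟩ − ∑_j x^1_n ⊗ y^n_j ⊗ z^j_1` (indices written 0-based). -/
def matMulRed (n : ℕ) (hn : 0 < n) :
    (Fin n × Fin n) → (Fin n × Fin n) → (Fin n × Fin n) → ℂ :=
  fun a b c =>
    matMulTensor n a b c -
      if a = (⟨0, hn⟩, ⟨n - 1, Nat.sub_lt hn Nat.one_pos⟩) ∧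
          b.1 = ⟨n - 1, Nat.sub_lt hn Nat.one_pos⟩ ∧ b.2 = c.1 ∧ c.2 = ⟨0, hn⟩
      then 1 else 0

open Finset

/-- The rank of a sum of matrices is at most the sum of the ranks. -/
theorem matrix_rank_sum_le {κ α β : Type*} [Finite α] [Fintype β] (s : Finset κ)
    (A : κ → Matrix α β ℂ) : (∑ l ∈ s, A l).rank ≤ ∑ l ∈ s, (A l).rank := by
  classical
  induction s using Finset.induction_on with
  | empty => simp
  | insert a s ha ih =>
    rw [sum_insert ha, sum_insert ha]
    refine le_trans ?_ (Nat.add_le_add_left ih _)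
    have h := LinearMap.rank_add_le (A a).mulVecLin (∑ l ∈ s, A l).mulVecLin
    rw [← Matrix.mulVecLin_add] at h
    unfold LinearMap.rank at h
    simp only [← Module.finrank_eq_rank] at h
    exact_mod_cast h

/-- A matrix with trivial kernel has full column rank. -/
theorem matrix_rank_eq_card_of_injective {α β : Type*} [Finite α] [Fintype β] (A : Matrix α β ℂ)
    (h : ∀ x, A.mulVec x = 0 → x = 0) : A.rank = Fintype.card β := by
  have hinj : Function.Injective A.mulVecLin := by
    rw [← LinearMap.ker_eq_bot, LinearMap.ker_eq_bot']
    exact h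
  rw [Matrix.rank, LinearMap.finrank_range_of_inj hinj, Module.finrank_fintype_fun_eq_card]

open scoped ComplexOrder in
/-- If a matrix depending continuously on a parameter is injective at a point in the closure of
`s`, then it has full column rank at some point of `s`. -/
theorem exists_rank_eq_card_of_mem_closure {X α β : Type*} [TopologicalSpace X] [Fintype α]
    [Fintype β] (F : X → Matrix α β ℂ) (hF : Continuous F) {s : Set X} {x : X}
    (hx : x ∈ closure s) (hinj : ∀ y, (F x).mulVec y = 0 → y = 0) :
    ∃ y ∈ s, (F y).rank = Fintype.card β := by
  classical
  have hdet : ((F x).conjTranspose * F x).det ≠ 0 := by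
    intro h0
    obtain ⟨v, hv, h⟩ := Matrix.exists_mulVec_eq_zero_iff.2 h0
    exact hv (hinj v ((Matrix.conjTranspose_mul_self_mulVec_eq_zero (F x) v).1 h))
  have hcont : Continuous fun y => ((F y).conjTranspose * F y).det :=
    (hF.matrix_conjTranspose.matrix_mul hF).matrix_det
  obtain ⟨y, hy, hys⟩ := mem_closure_iff.1 hx _ (isOpen_ne.preimage hcont) hdet
  refine ⟨y, hys, ?_⟩
  rw [← Matrix.rank_conjTranspose_mul_self]
  exact Matrix.rank_of_det_ne_zero hy

/-- The sign relating `e_k ∧ e_S` to `e_{S ∪ {k}}`. -/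
def wedgeSign {N : ℕ} (k : Fin N) (S : Finset (Fin N)) : ℂ :=
  (-1) ^ #{s ∈ S | s < k}

/-- The coefficient of `e_T` in `e_k ∧ e_S`. -/
def wedgeCoeff {N : ℕ} (k : Fin N) (T S : Finset (Fin N)) : ℂ :=
  if k ∉ S ∧ T = insert k S then wedgeSign k S else 0

/-- The matrix of `e_S ↦ u ∧ e_S` on the exterior algebra of `ℂ^N`. -/
def wedgeMatrix {N : ℕ} (u : Fin N → ℂ) : Matrix (Finset (Fin N)) (Finset (Fin N)) ℂ :=
  fun T S => ∑ k, u k * wedgeCoeff k T S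

theorem wedgeSign_ne_zero {N : ℕ} (k : Fin N) (S : Finset (Fin N)) : wedgeSign k S ≠ 0 :=
  pow_ne_zero _ (by norm_num)

theorem wedgeSign_insert {N : ℕ} {k l : Fin N} {S : Finset (Fin N)} (hl : l ∉ S) :
    wedgeSign k (insert l S) = if l < k then - wedgeSign k S else wedgeSign k S := by
  unfold wedgeSign
  rw [filter_insert]
  split_ifs with h
  · rw [card_insert_of_notMem (by simp [hl]), pow_succ]
    ring
  · rfl

/-- Wedging by `e_l` and then by `e_k` is antisymmetric in `k` and `l`. -/
theorem wedgeCoeff_insert_antisymm {N : ℕ} (k l : Fin N) (T R : Finset (Fin N)) :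
    (if l ∉ R then wedgeCoeff k T (insert l R) * wedgeSign l R else 0) =
      -(if k ∉ R then wedgeCoeff l T (insert k R) * wedgeSign k R else 0) := by
  rcases eq_or_ne k l with rfl | hkl
  · simp [wedgeCoeff]
  by_cases hl : l ∈ R
  · simp [hl, wedgeCoeff]
  by_cases hk : k ∈ R
  · simp [hk, wedgeCoeff]
  simp only [hl, hk, not_false_eq_true, if_true, wedgeCoeff, mem_insert, hkl, hkl.symm, false_or,
    true_and, wedgeSign_insert hl, wedgeSign_insert hk, Finset.insert_comm l k]
  split_ifs with h1 h2 h3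
  · exact absurd h3 h2.asymm
  · ring
  · ring
  · exact absurd (lt_of_le_of_ne (not_lt.1 h2) hkl) (by assumption)
  · simp

/-- Wedging twice by the same vector is zero. -/
theorem wedgeMatrix_mul_self {N p : ℕ} (u : Fin N → ℂ) (T R : Finset (Fin N)) (hR : #R = p) :
    ∑ S : {S : Finset (Fin N) // #S = p + 1}, wedgeMatrix u T S * wedgeMatrix u S R = 0 := by
  have key : ∀ k l : Fin N,
      ∑ S : {S : Finset (Fin N) // #S = p + 1}, wedgeCoeff k T S * wedgeCoeff l S R =
        if l ∉ R then wedgeCoeff k T (insert l R) * wedgeSign l R else 0 := by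
    intro k l
    split_ifs with hl
    · exact Finset.sum_eq_zero fun S _ => by simp [wedgeCoeff, hl]
    · rw [Finset.sum_eq_single ⟨insert l R, by rw [card_insert_of_notMem hl, hR]⟩]
      · simp [wedgeCoeff, hl]
      · rintro ⟨S, hS⟩ - hne
        have : S ≠ insert l R := fun h => hne (Subtype.ext h)
        simp [wedgeCoeff, this]
      · simp
  have h1 : ∑ S : {S : Finset (Fin N) // #S = p + 1}, wedgeMatrix u T S * wedgeMatrix u S R =
      ∑ k, ∑ l, u k * u l *
        (if l ∉ R then wedgeCoeff k T (insert l R) * wedgeSign l R else 0) := by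
    simp only [← key, mul_sum]
    simp only [wedgeMatrix, sum_mul_sum]
    rw [sum_comm]
    refine sum_congr rfl fun k _ => ?_
    rw [sum_comm]
    exact sum_congr rfl fun l _ => sum_congr rfl fun S _ => by ring
  have h2 := h1
  rw [sum_comm] at h2
  have h3 : ∑ l, ∑ k, u k * u l *
        (if l ∉ R then wedgeCoeff k T (insert l R) * wedgeSign l R else 0) =
      - ∑ k, ∑ l, u k * u l *
        (if l ∉ R then wedgeCoeff k T (insert l R) * wedgeSign l R else 0) := by
    simp only [← sum_neg_distrib]
    refine sum_congr rfl fun l _ => sum_congr rfl fun k _ => ?_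
    rw [wedgeCoeff_insert_antisymm]
    ring
  rw [h3, ← h1] at h2
  exact self_eq_neg.1 h2

/-- The rank of `u ∧ · : Λ^{p+1} ℂ^{N+1} → Λ^{p+2} ℂ^{N+1}` is at most `N.choose (p + 1)`. -/
theorem rank_wedgeMatrix_le {N p : ℕ} (u : Fin (N + 1) → ℂ) :
    ((wedgeMatrix u).submatrix id
      (Subtype.val : {S : Finset (Fin (N + 1)) // #S = p + 1} → _)).rank ≤ N.choose (p + 1) := by
  classical
  by_cases hu : u = 0
  · have : (wedgeMatrix u).submatrix id
      (Subtype.val : {S : Finset (Fin (N + 1)) // #S = p + 1} → _) = 0 := by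
      ext T S
      simp [wedgeMatrix, hu]
    rw [this, Matrix.rank_zero]
    exact Nat.zero_le _
  obtain ⟨q, hq⟩ := Function.ne_iff.1 hu
  let B : Matrix {S : Finset (Fin (N + 1)) // #S = p + 1}
      {R : Finset (Fin (N + 1)) // #R = p ∧ q ∉ R} ℂ := fun S R => wedgeMatrix u S R
  have hAB : (wedgeMatrix u).submatrix id
      (Subtype.val : {S : Finset (Fin (N + 1)) // #S = p + 1} → _) * B = 0 := by
    ext T R
    exact wedgeMatrix_mul_self u T R.1 R.2.1
  have hB : B.rank = N.choose p := by
    rw [matrix_rank_eq_card_of_injective, Fintype.card_subtype]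
    · have : ({R : Finset (Fin (N + 1)) | #R = p ∧ q ∉ R} : Finset _) =
          powersetCard p (univ.erase q) := by
        ext R
        simp only [mem_filter, mem_univ, true_and, mem_powersetCard, subset_erase, subset_univ]
        exact and_comm
      rw [this, card_powersetCard, card_erase_of_mem (mem_univ q)]
      simp
    · intro x hx
      ext R
      have h := congrFun hx ⟨insert q R.1, by rw [card_insert_of_notMem R.2.2, R.2.1]⟩
      have hterm : ∀ R' : {R : Finset (Fin (N + 1)) // #R = p ∧ q ∉ R},
          wedgeMatrix u (insert q R.1) R' = if R' = R then u q * wedgeSign q R.1 else 0 := by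
        intro R'
        unfold wedgeMatrix
        rw [Finset.sum_eq_single q]
        · have : insert q R.1 = insert q R'.1 ↔ R' = R := by
            refine ⟨fun h => Subtype.ext ?_, fun h => by rw [h]⟩
            rw [← erase_insert R.2.2, h, erase_insert R'.2.2]
          simp only [wedgeCoeff, R'.2.2, not_false_eq_true, true_and, this]
          split_ifs with h
          · rw [h]
          · simp
        · intro k _ hk
          have : insert q R.1 ≠ insert k R'.1 := fun h => by
            have := h ▸ mem_insert_self q R.1
            rcases mem_insert.1 this with h | h
            · exact hk h.symm
            · exact R'.2.2 h
          simp [wedgeCoeff, this]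
        · simp
      simp only [Matrix.mulVec, dotProduct, B, hterm, Pi.zero_apply, ite_mul, zero_mul,
        sum_ite_eq', mem_univ, if_true] at h
      exact (mul_eq_zero.1 h).resolve_left (mul_ne_zero hq (wedgeSign_ne_zero _ _))
  have h := Matrix.rank_add_rank_le_card_of_mul_eq_zero hAB
  rw [hB, Fintype.card_finset_len, Fintype.card_fin, Nat.choose_succ_succ'] at h
  omega

/-- If `#S = m`, the `j`-th element `t` of the complement of `S` has `t - j` elements of `S`
below it. -/
theorem exists_notMem_val_eq_add_card {m : ℕ} (S : Finset (Fin (2 * m + 1))) (hS : #S = m)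
    (j : Fin (m + 1)) : ∃ t, t ∉ S ∧ t.val = j.val + #{s ∈ S | s < t} := by
  have hc : #Sᶜ = m + 1 := by
    rw [card_compl, hS, Fintype.card_fin]
    omega
  have hmem := Sᶜ.orderEmbOfFin_mem hc j
  set t := Sᶜ.orderEmbOfFin hc j with ht
  refine ⟨t, by simpa using hmem, ?_⟩
  have h1 : {s ∈ Sᶜ | s < t} = (Iio j).map (Sᶜ.orderEmbOfFin hc).toEmbedding := by
    ext s
    simp only [mem_filter, mem_map, mem_Iio, RelEmbedding.coe_toEmbedding]
    constructor
    · rintro ⟨hs, hst⟩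
      have : s ∈ Set.range (Sᶜ.orderEmbOfFin hc) := by
        rw [range_orderEmbOfFin]
        exact hs
      obtain ⟨a, rfl⟩ := this
      exact ⟨a, (Sᶜ.orderEmbOfFin hc).lt_iff_lt.1 hst, rfl⟩
    · rintro ⟨a, ha, rfl⟩
      exact ⟨Sᶜ.orderEmbOfFin_mem hc a, (Sᶜ.orderEmbOfFin hc).lt_iff_lt.2 ha⟩
  have h2 : #{s ∈ Sᶜ | s < t} = j.val := by rw [h1, card_map, Fin.card_Iio]
  have h3 : #{s ∈ S | s < t} + #{s ∈ Sᶜ | s < t} = t.val := by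
    rw [← card_union_of_disjoint
      ((disjoint_compl_right (a := S)).mono (filter_subset _ _) (filter_subset _ _)),
      ← filter_union, union_compl, ← Fin.card_Iio]
    congr 1
    ext
    simp
  omega

theorem card_filter_lt_add_le {N : ℕ} (S : Finset (Fin N)) {x y : Fin N} (hxy : x ≤ y) :
    #{s ∈ S | s < y} + x.val ≤ #{s ∈ S | s < x} + y.val := by
  have h : ({s ∈ S | s < y} : Finset _) ⊆ {s ∈ S | s < x} ∪ Ico x y := by
    intro s hs
    simp only [mem_filter, mem_union, mem_Ico] at hs ⊢
    rcases lt_or_ge s x with h | h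
    · exact Or.inl ⟨hs.1, h⟩
    · exact Or.inr ⟨h, hs.2⟩
  have h1 := (card_le_card h).trans (card_union_le _ _)
  rw [Fin.card_Ico] at h1
  have : x.val ≤ y.val := hxy
  omega

/-- The index of the entry in row `i` and column `j` of a Hankel matrix. -/
def hankelIndex {m : ℕ} (i j : Fin (m + 1)) : Fin (2 * m + 1) := ⟨i.val + j.val, by omega⟩

/-- The potential that makes the Koszul flattening of the Hankel matrix triangular. -/
def hankelPotential {N : ℕ} (S : Finset (Fin N)) (t : Fin N) : ℕ :=
  2 * ∑ s ∈ S, 3 ^ s.val + 3 ^ t.val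

/-- The potential strictly increases along off-diagonal entries. -/
theorem hankelPotential_lt {m : ℕ} {S S' : Finset (Fin (2 * m + 1))} {i j' : Fin (m + 1)}
    {t t' : Fin (2 * m + 1)} (ht : t ∉ S) (hi : i.val = #{s ∈ S | s < t})
    (ht' : t'.val = j'.val + #{s ∈ S' | s < t'})
    (hs : hankelIndex i j' ∉ S') (hT : insert t S = insert (hankelIndex i j') S')
    (hne : hankelIndex i j' ≠ t) : hankelPotential S t < hankelPotential S' t' := by
  set s := hankelIndex i j' with hsdef
  have hsval : s.val = i.val + j'.val := rfl
  have htS' : t ∈ S' := (mem_insert.1 (hT ▸ mem_insert_self t S)).resolve_left hne.symm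
  have hmax : s < t ∨ s < t' := by
    by_contra! hcon
    obtain ⟨h1, h2⟩ := hcon
    have hlt : t < s := lt_of_le_of_ne h1 hne.symm
    have hmono := card_filter_lt_add_le S' h2
    have hcard : #{x ∈ S | x < t} + 1 ≤ #{x ∈ S' | x < s} := by
      rw [← card_insert_of_notMem (a := t) (by simp)]
      refine card_le_card fun x hx => ?_
      rcases mem_insert.1 hx with rfl | hx
      · exact mem_filter.2 ⟨htS', hlt⟩
      · rw [mem_filter] at hx ⊢
        have hxs := hx.2.trans hlt
        exact ⟨(mem_insert.1 (hT ▸ mem_insert_of_mem hx.1)).resolve_left hxs.ne, hxs⟩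
    omega
  have hsum : 3 ^ t.val + ∑ x ∈ S, 3 ^ x.val = 3 ^ s.val + ∑ x ∈ S', 3 ^ x.val := by
    rw [← sum_insert (f := fun x : Fin (2 * m + 1) => 3 ^ x.val) ht, hT, sum_insert hs]
  have hpow : ∀ y : Fin (2 * m + 1), s < y → 3 * 3 ^ s.val ≤ 3 ^ y.val := fun y hy => by
    rw [← pow_succ']
    exact Nat.pow_le_pow_right (by norm_num) hy
  have hpos1 : 0 < 3 ^ t.val := by positivity
  have hpos2 : 0 < 3 ^ t'.val := by positivity
  have hpos3 : 0 < 3 ^ s.val := by positivity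
  unfold hankelPotential
  rcases hmax with h | h
  · have := hpow t h
    omega
  · have := hpow t' h
    omega

/-- The Koszul flattening of the Hankel matrix with its bottom left corner removed has a kernel of
dimension at most one. -/
theorem eq_zero_of_hankel_koszul {m : ℕ} (x : {S : Finset (Fin (2 * m + 1)) // #S = m} →
      Fin (m + 1) → ℂ)
    (hx : ∀ S, S.1 = ({s | s.val < m} : Finset _) → x S 0 = 0)
    (h : ∀ T i, ∑ S, ∑ j, (if i = Fin.last m ∧ j = 0 then 0
      else wedgeCoeff (hankelIndex i j) T S.1) * x S j = 0) : x = 0 := by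
  classical
  choose τ hτ hτval using fun S : {S : Finset (Fin (2 * m + 1)) // #S = m} =>
    exists_notMem_val_eq_add_card S.1 S.2
  by_contra hne
  have hex : ∃ q : {S : Finset (Fin (2 * m + 1)) // #S = m} × Fin (m + 1), x q.1 q.2 ≠ 0 := by
    by_contra! hcon
    exact hne (funext₂ fun S j => hcon (S, j))
  obtain ⟨⟨S, j⟩, hmem, hmax⟩ := exists_max_image
    {q : {S : Finset (Fin (2 * m + 1)) // #S = m} × Fin (m + 1) | x q.1 q.2 ≠ 0}
    (fun q => hankelPotential q.1.1 (τ q.1 q.2))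
    (by obtain ⟨q, hq⟩ := hex; exact ⟨q, by simpa using hq⟩)
  simp only [mem_filter, mem_univ, true_and, Prod.forall] at hmem hmax
  set t := τ S j with ht
  have hcard : #{s ∈ S.1 | s < t} ≤ m := (card_filter_le _ _).trans S.2.le
  set i : Fin (m + 1) := ⟨#{s ∈ S.1 | s < t}, by omega⟩ with hi
  have hidx : hankelIndex i j = t := by
    ext
    rw [hτval S j]
    exact Nat.add_comm _ _
  have hcorner : ¬ (i = Fin.last m ∧ j = 0) := by
    rintro ⟨hi', rfl⟩
    refine hmem (hx S ?_)
    have h1 : #{s ∈ S.1 | s < t} = m := congrArg Fin.val hi'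
    have h2 : t.val = m := by rw [hτval S 0, h1]; simp
    have h3 : {s ∈ S.1 | s < t} = S.1 := eq_of_subset_of_card_le (filter_subset _ _) (by omega)
    refine eq_of_subset_of_card_le (fun s hs => ?_) ?_
    · rw [← h3, mem_filter] at hs
      have := hs.2
      simp only [mem_filter, mem_univ, true_and]
      omega
    · have : ({s | s.val < m} : Finset (Fin (2 * m + 1))) = Iio t := by
        ext s
        simp only [mem_filter, mem_univ, true_and, mem_Iio]
        omega
      rw [this, Fin.card_Iio, S.2, h2]
  have heq := h (insert t S.1) i
  rw [sum_eq_single S, sum_eq_single j, if_neg hcorner, hidx] at heq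
  · have hc : wedgeCoeff t (insert t S.1) S.1 = wedgeSign t S.1 := by
      simp [wedgeCoeff, hτ S j, ht]
    rw [hc] at heq
    exact hmem ((mul_eq_zero.1 heq).resolve_left (wedgeSign_ne_zero _ _))
  · intro j' _ hj'
    have : hankelIndex i j' ≠ t := fun h => hj' (Fin.ext (by
      have h1 := congrArg Fin.val (h.trans hidx.symm)
      simp only [hankelIndex] at h1
      omega))
    have hc : wedgeCoeff (hankelIndex i j') (insert t S.1) S.1 = 0 := by
      refine if_neg fun hcon => ?_
      have h1 := hcon.2 ▸ mem_insert_self t S.1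
      rcases mem_insert.1 h1 with h1 | h1
      · exact this h1.symm
      · exact hτ S j h1
    simp [hc]
  · simp
  · intro S' _ hS'
    refine sum_eq_zero fun j' _ => ?_
    by_contra hcon
    have hx' := right_ne_zero_of_mul hcon
    have hw := left_ne_zero_of_mul hcon
    have hw' : hankelIndex i j' ∉ S'.1 ∧ insert t S.1 = insert (hankelIndex i j') S'.1 := by
      by_contra hno
      simp [wedgeCoeff, if_neg hno] at hw
    refine (hmax S' j' hx').not_gt (hankelPotential_lt (hτ S j) rfl (hτval S' j') hw'.1 hw'.2 ?_)
    intro hk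
    refine hS' (Subtype.ext ?_)
    rw [← erase_insert hw'.1, ← hw'.2, hk, erase_insert (hτ S j)]
  · simp

/-- The Koszul flattening `Λ^p ℂ^N ⊗ B* → Λ^{p+1} ℂ^N ⊗ C` of the tensor `T` after the coordinate
projection `A → ℂ^N` given by `f`. -/
def koszulMatrix {A B C : Type*} [Fintype A] {N : ℕ} (p : ℕ) (f : A → Fin N) (T : A → B → C → ℂ) :
    Matrix (Finset (Fin N) × C) ({S : Finset (Fin N) // #S = p} × B) ℂ :=
  fun Y X => ∑ a, T a X.2 Y.2 * wedgeCoeff (f a) Y.1 X.1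

theorem continuous_koszulMatrix {A B C : Type*} [Fintype A] {N : ℕ} (p : ℕ) (f : A → Fin N) :
    Continuous (koszulMatrix p f : (A → B → C → ℂ) → _) :=
  continuous_matrix fun Y X => by
    unfold koszulMatrix
    fun_prop

/-- The rank of the Koszul flattening is at most the tensor rank times the rank of the flattening
of a rank one tensor. -/
theorem rank_koszulMatrix_le {A B C : Type*} [Fintype A] [Fintype B] [Fintype C] {N p r : ℕ}
    (f : A → Fin (N + 1)) {T : A → B → C → ℂ} (hT : tensorRankLE r T) :
    (koszulMatrix (p + 1) f T).rank ≤ r * N.choose (p + 1) := by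
  classical
  obtain ⟨u, v, w, hT⟩ := hT
  let u' : Fin r → Fin (N + 1) → ℂ := fun l k => ∑ a with f a = k, u l a
  let M : Fin r → Matrix (Finset (Fin (N + 1))) {S : Finset (Fin (N + 1)) // #S = p + 1} ℂ :=
    fun l => (wedgeMatrix (u' l)).submatrix id Subtype.val
  let P : Fin r → Matrix (Finset (Fin (N + 1)) × C) (Finset (Fin (N + 1))) ℂ :=
    fun l Y T => if Y.1 = T then w l Y.2 else 0
  let Q : Fin r → Matrix {S : Finset (Fin (N + 1)) // #S = p + 1}
      ({S : Finset (Fin (N + 1)) // #S = p + 1} × B) ℂ :=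
    fun l S X => if S = X.1 then v l X.2 else 0
  have hsum : koszulMatrix (p + 1) f T = ∑ l, P l * M l * Q l := by
    ext Y X
    have hl : ∀ l, (P l * M l * Q l) Y X =
        ∑ a, u l a * v l X.2 * w l Y.2 * wedgeCoeff (f a) Y.1 X.1 := by
      intro l
      have h1 : ∑ a, u l a * wedgeCoeff (f a) Y.1 X.1 = wedgeMatrix (u' l) Y.1 X.1 := by
        simp only [wedgeMatrix, u', sum_mul]
        rw [← sum_fiberwise (univ : Finset A) f]
        refine sum_congr rfl fun k _ => sum_congr rfl fun a ha => ?_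
        rw [(mem_filter.1 ha).2]
      have h2 : (P l * M l * Q l) Y X = w l Y.2 * wedgeMatrix (u' l) Y.1 X.1 * v l X.2 := by
        simp only [Matrix.mul_apply]
        simp [P, Q, M]
      rw [h2, ← h1, mul_sum, sum_mul]
      exact sum_congr rfl fun a _ => by ring
    simp only [Matrix.sum_apply, hl, koszulMatrix, hT, sum_mul]
    exact sum_comm
  rw [hsum]
  calc (∑ l, P l * M l * Q l).rank ≤ ∑ l, (P l * M l * Q l).rank := matrix_rank_sum_le _ _
    _ ≤ ∑ _l : Fin r, N.choose (p + 1) := sum_le_sum fun l _ =>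
      (Matrix.rank_mul_le_left _ _).trans
        ((Matrix.rank_mul_le_right _ _).trans (rank_wedgeMatrix_le (u' l)))
    _ = r * N.choose (p + 1) := by simp

/-- Every tensor over finite index types has finite rank. -/
theorem exists_tensorRankLE {A B C : Type*} [Fintype A] [Fintype B] [Fintype C]
    (T : A → B → C → ℂ) : ∃ r, tensorRankLE r T := by
  classical
  let e := Fintype.equivFin (A × B × C)
  refine ⟨Fintype.card (A × B × C), fun l a => if (e.symm l).1 = a then 1 else 0,
    fun l b => if (e.symm l).2.1 = b then 1 else 0,
    fun l c => if (e.symm l).2.2 = c then T (e.symm l).1 (e.symm l).2.1 c else 0, fun a b c => ?_⟩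
  rw [e.symm.sum_comp fun q : A × B × C => (if q.1 = a then (1 : ℂ) else 0) *
    (if q.2.1 = b then 1 else 0) * (if q.2.2 = c then T q.1 q.2.1 c else 0)]
  simp only [Fintype.sum_prod_type]
  simp

/-- The projection from matrices to Hankel matrices, sending the top right corner to row `m` and
column `0`. -/
def hankelProjection {m : ℕ} (a : Fin (m + 1) × Fin (m + 1)) : Fin (2 * m + 1) :=
  hankelIndex a.1.rev a.2.rev

/-- The columns that survive when the kernel of the Koszul flattening is cut away. -/
abbrev KoszulColumn (m : ℕ) : Type :=
  {X : {S : Finset (Fin (2 * m + 1)) // #S = m} × (Fin (m + 1) × Fin (m + 1)) //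
    ¬ (X.1.1 = ({s | s.val < m} : Finset _) ∧ X.2.1 = Fin.last m)}

theorem card_koszulColumn (m : ℕ) :
    (2 * m + 1).choose m * ((m + 1) * (m + 1)) ≤ Fintype.card (KoszulColumn m) + (m + 1) := by
  have h : Fintype.card (KoszulColumn m) = _ := Fintype.card_subtype_compl
    (fun X : {S : Finset (Fin (2 * m + 1)) // #S = m} × (Fin (m + 1) × Fin (m + 1)) =>
      X.1.1 = ({s | s.val < m} : Finset _) ∧ X.2.1 = Fin.last m)
  have h1 : Fintype.card {X : {S : Finset (Fin (2 * m + 1)) // #S = m} ×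
      (Fin (m + 1) × Fin (m + 1)) // X.1.1 = ({s | s.val < m} : Finset _) ∧
        X.2.1 = Fin.last m} ≤ m + 1 := by
    refine (Fintype.card_le_of_injective (fun X => X.1.2.2) ?_).trans_eq (Fintype.card_fin _)
    rintro ⟨⟨⟨S, hS⟩, b⟩, h, h'⟩ ⟨⟨⟨S', hS'⟩, b'⟩, k, k'⟩ hb
    simp only at h h' k k' hb
    simp [h, k, Prod.ext_iff, h', k', hb]
  simp only [Fintype.card_prod, Fintype.card_finset_len, Fintype.card_fin] at h
  omega

/-- The Koszul flattening of the reduced matrix multiplication tensor is injective on the span of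
the surviving columns. -/
theorem koszulMatrix_matMulRed_injective (m : ℕ) (hm : 0 < m + 1) (y : KoszulColumn m → ℂ)
    (hy : ((koszulMatrix m hankelProjection (matMulRed (m + 1) hm)).submatrix id
      Subtype.val).mulVec y = 0) : y = 0 := by
  classical
  let z : {S : Finset (Fin (2 * m + 1)) // #S = m} × (Fin (m + 1) × Fin (m + 1)) → ℂ :=
    fun X => if h : ¬ (X.1.1 = ({s | s.val < m} : Finset _) ∧ X.2.1 = Fin.last m)
      then y ⟨X, h⟩ else 0
  have hz : ∀ Y, ∑ X, koszulMatrix m hankelProjection (matMulRed (m + 1) hm) Y X * z X = 0 := by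
    intro Y
    refine Eq.trans ?_ (congrFun hy Y)
    simp only [Matrix.mulVec, dotProduct, Matrix.submatrix_apply, id]
    rw [← Fintype.sum_subtype_add_sum_subtype (fun X :
      {S : Finset (Fin (2 * m + 1)) // #S = m} × (Fin (m + 1) × Fin (m + 1)) =>
      ¬ (X.1.1 = ({s | s.val < m} : Finset _) ∧ X.2.1 = Fin.last m))]
    rw [Fintype.sum_eq_zero (fun X : {X : {S : Finset (Fin (2 * m + 1)) // #S = m} ×
      (Fin (m + 1) × Fin (m + 1)) // ¬ ¬ (X.1.1 = ({s | s.val < m} : Finset _) ∧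
        X.2.1 = Fin.last m)} => _) (fun X => by simp only [z, dif_neg X.2, mul_zero]), add_zero]
    exact sum_congr rfl fun X _ => by simp only [z, dif_pos X.2]
  have hentry : ∀ (T : Finset (Fin (2 * m + 1))) (i : Fin (m + 1)) (k : Fin (m + 1))
      (S : {S : Finset (Fin (2 * m + 1)) // #S = m}) (b : Fin (m + 1) × Fin (m + 1)),
      koszulMatrix m hankelProjection (matMulRed (m + 1) hm) (T, (k, i.rev)) (S, b) =
        if b.2 = k then (if i = Fin.last m ∧ b.1.rev = 0 then 0
          else wedgeCoeff (hankelIndex i b.1.rev) T S.1) else 0 := by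
    intro T i k S b
    unfold koszulMatrix
    rw [Finset.sum_eq_single (i.rev, b.1)]
    · have h0 : (⟨0, hm⟩ : Fin (m + 1)) = (Fin.last m).rev := by simp
      have h1 : (⟨m + 1 - 1, Nat.sub_lt hm Nat.one_pos⟩ : Fin (m + 1)) = (0 : Fin (m + 1)).rev := by
        ext; simp
      simp only [matMulRed, matMulTensor, hankelProjection, Fin.rev_rev, h0, h1, Prod.mk.injEq,
        Fin.rev_eq_iff]
      by_cases hb : b.2 = k <;> by_cases hi : i = Fin.last m <;>
        by_cases hj : b.1 = Fin.last m <;> simp [hb, hi, hj]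
    · rintro ⟨a1, a2⟩ - hne
      simp only [matMulRed, matMulTensor]
      rw [if_neg, if_neg]
      · simp
      · rintro ⟨h1, h2, h3, h4⟩
        exact hne (by rw [h1, ← h2, ← h4])
      · rintro ⟨h1, h2, h3⟩
        exact hne (by rw [h1, ← h3])
    · simp
  have hzero : ∀ k, (fun S j => z (S, (Fin.rev j, k))) = 0 := by
    intro k
    refine eq_zero_of_hankel_koszul _ (fun S hS => ?_) (fun T i => ?_)
    · simp [z, hS]
    · refine Eq.trans ?_ (hz (T, (k, i.rev)))
      rw [Fintype.sum_prod_type]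
      refine sum_congr rfl fun S _ => ?_
      rw [Fintype.sum_prod_type, ← Equiv.sum_comp Fin.revPerm]
      refine sum_congr rfl fun j _ => ?_
      simp only [hentry, Fin.revPerm_apply, Fin.rev_rev, ite_mul, zero_mul, sum_ite_eq', mem_univ,
        if_true]
  ext ⟨⟨S, b⟩, h⟩
  have h1 := congrFun (congrFun (hzero b.2) S) b.1.rev
  simpa only [Fin.rev_rev, z, dif_pos h, Pi.zero_apply, Prod.mk.eta] using h1

/-- The border rank bound with the Koszul flattening dimensions still explicit. -/
theorem card_koszulColumn_le_of_borderRankLE {p r : ℕ} (hp : 0 < p + 1 + 1)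
    (h : borderRankLE r (matMulRed (p + 1 + 1) hp)) :
    Fintype.card (KoszulColumn (p + 1)) ≤ r * (2 * (p + 1)).choose (p + 1) := by
  obtain ⟨T, hT, hrank⟩ := exists_rank_eq_card_of_mem_closure
    (fun T => (koszulMatrix (p + 1) hankelProjection T).submatrix id
      (Subtype.val : KoszulColumn (p + 1) → _))
    ((continuous_koszulMatrix _ _).matrix_submatrix _ _) h
    (koszulMatrix_matMulRed_injective (p + 1) hp)
  rw [← hrank]
  exact (Matrix.rank_submatrix_le _ _ _).trans (rank_koszulMatrix_le _ hT)

/-- For `n ≥ 3`, the border rank of the reduced matrix multiplication tensor satisfies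
`R̲(M_⟨n⟩^red) ≥ 2n² − n`. -/
theorem stmt5 (n : ℕ) (hn : 3 ≤ n) :
    2 * n ^ 2 - n ≤ borderRank (matMulRed n (by omega)) := by
  refine le_csInf ?_ fun r hr => ?_
  · obtain ⟨r, hr⟩ := exists_tensorRankLE (matMulRed n (by omega))
    exact ⟨r, subset_closure hr⟩
  obtain ⟨p, rfl⟩ : ∃ p, n = p + 1 + 1 := ⟨n - 2, by omega⟩
  have h1 := card_koszulColumn_le_of_borderRankLE _ hr
  have h2 := card_koszulColumn (p + 1)
  have h3 := Nat.choose_mul_succ_eq (2 * (p + 1)) (p + 1)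
  have h4 : p + 1 + 1 < (2 * (p + 1)).choose (p + 1) := by
    have h5 := Nat.choose_le_centralBinom 1 (p + 1)
    rw [Nat.choose_one_right, Nat.centralBinom] at h5
    omega
  rw [show 2 * (p + 1) + 1 - (p + 1) = p + 1 + 1 by omega] at h3
  have h6 : 2 * (p + 1 + 1) ^ 2 - (p + 1 + 1) = (p + 1 + 1) * (2 * (p + 1) + 1) := by
    rw [Nat.sub_eq_iff_eq_add (by nlinarith)]
    ring
  rw [h6]
  by_contra! hlt
  nlinarith
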